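/- arXiv:2207.14586 — 5 statements merged into one kernel-verified Lean document; each statement's English description precedes it below -/
import Mathlib

section
/- For every nonnegative integer n, the number of partitions of n equals the number of partitions λ with distinct parts satisfying λ_1 + λ_3 + λ_5 + ⋯ = n. -/
/-- A partition: a weakly decreasing sequence of naturals with finite support.
`p.parts i` is the `(i+1)`-st part, i.e. parts are 0-indexed (`λ_1 = p.parts 0`). -/
structure Ptn where
  parts : ℕ → ℕ
  antitone' : ∀ ⦃i j : ℕ⦄, i ≤ j → parts j ≤ parts i
  finite_support' : (Function.support parts).Finite

namespace Ptn

/-- The size `|λ|` of a partition: the sum of all its parts. -/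
noncomputable def size (p : Ptn) : ℕ := ∑ᶠ i, p.parts i

/-- The number of (nonzero) parts `ℓ(λ)`. -/
noncomputable def length (p : Ptn) : ℕ := (Function.support p.parts).ncard

/-- A partition has distinct parts if no nonzero value is repeated. -/
def Distinct (p : Ptn) : Prop := ∀ i : ℕ, p.parts (i + 1) ≠ 0 → p.parts (i + 1) < p.parts i

/-- A partition has odd parts if every part is odd. -/
def OddParts (p : Ptn) : Prop := ∀ i : ℕ, p.parts i ≠ 0 → Odd (p.parts i)

end Ptn

open Finset in
theorem Finset.card_eq_finsum_card_fiber {α β : Type*} [DecidableEq β] (s : Finset α) (f : α → β) :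
    #s = ∑ᶠ b, #{a ∈ s | f a = b} := by
  rw [finsum_eq_sum_of_support_subset (s := s.image f)]
  · exact card_eq_sum_card_fiberwise fun a ha => mem_coe.2 (mem_image_of_mem f ha)
  · intro b hb
    obtain ⟨a, ha⟩ := card_ne_zero.1 hb
    rw [mem_filter] at ha
    exact mem_coe.2 (mem_image.2 ⟨a, ha⟩)

namespace Ptn

@[ext]
theorem ext {p q : Ptn} (h : ∀ i, p.parts i = q.parts i) : p = q := by
  obtain ⟨f, _, _⟩ := p
  obtain ⟨g, _, _⟩ := q
  obtain rfl : f = g := funext h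
  rfl

theorem exists_parts_eq_zero (p : Ptn) : ∃ N, ∀ n, N ≤ n → p.parts n = 0 := by
  obtain ⟨M, hM⟩ := p.finite_support'.bddAbove
  refine ⟨M + 1, fun n hn => ?_⟩
  by_contra h
  have := hM h
  omega

end Ptn

namespace YoungDiagram

theorem lt_colLen_iff_lt_rowLen (Y : YoungDiagram) {i j : ℕ} : i < Y.colLen j ↔ j < Y.rowLen i := by
  rw [← mem_iff_lt_colLen, mem_iff_lt_rowLen]

/-- The partition whose parts are the row lengths of a Young diagram. -/
def rowPtn (Y : YoungDiagram) : Ptn where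
  parts := Y.rowLen
  antitone' _ _ h := Y.rowLen_anti _ _ h
  finite_support' := by
    refine (Set.finite_Iio (Y.colLen 0)).subset fun i hi => ?_
    exact Y.lt_colLen_iff_lt_rowLen.2 (Nat.pos_of_ne_zero hi)

theorem rowPtn_injective : Function.Injective rowPtn := by
  intro Y Z h
  have hrow : ∀ i, Y.rowLen i = Z.rowLen i := fun i => congrFun (congrArg Ptn.parts h) i
  ext ⟨i, j⟩
  simp only [mem_cells, mem_iff_lt_rowLen, hrow]

theorem rowPtn_surjective : Function.Surjective rowPtn := by
  intro p
  have hfin : {c : ℕ × ℕ | c.2 < p.parts c.1}.Finite := by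
    refine (p.finite_support'.prod (Set.finite_Iio (p.parts 0))).subset fun c hc => ?_
    have hc : c.2 < p.parts c.1 := hc
    exact ⟨(Nat.zero_lt_of_lt hc).ne', hc.trans_le (p.antitone' (Nat.zero_le _))⟩
  let Y : YoungDiagram := ⟨hfin.toFinset, by
    rintro ⟨i, j⟩ ⟨i', j'⟩ ⟨hi, hj⟩ h
    simp only [Set.Finite.coe_toFinset, Set.mem_ofPred_eq] at h ⊢
    exact (hj.trans_lt h).trans_le (p.antitone' hi)⟩
  refine ⟨Y, Ptn.ext fun i => eq_of_forall_lt_iff fun j => ?_⟩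
  change j < Y.rowLen i ↔ _
  rw [← mem_iff_lt_rowLen, ← mem_cells]
  simp [Y]

theorem size_rowPtn (Y : YoungDiagram) : Y.rowPtn.size = Y.card := by
  rw [YoungDiagram.card, Finset.card_eq_finsum_card_fiber _ Prod.fst]
  exact finsum_congr fun i => Y.rowLen_eq_card

/-- The number of cells weakly to the right of the diagonal in row `k`. -/
def arm (Y : YoungDiagram) (k : ℕ) : ℕ := Y.rowLen k - k

/-- The number of cells strictly below the diagonal in column `k`. -/
def leg (Y : YoungDiagram) (k : ℕ) : ℕ := Y.colLen k - (k + 1)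

theorem arm_antitone (Y : YoungDiagram) : Antitone Y.arm :=
  fun _ _ h => tsub_le_tsub (Y.rowLen_anti _ _ h) h

theorem leg_antitone (Y : YoungDiagram) : Antitone Y.leg :=
  fun _ _ h => tsub_le_tsub (Y.colLen_anti _ _ h) (Nat.succ_le_succ h)

theorem arm_eq_zero (Y : YoungDiagram) {k : ℕ} (h : Y.rowLen 0 ≤ k) : Y.arm k = 0 :=
  Nat.sub_eq_zero_of_le ((Y.rowLen_anti _ _ (Nat.zero_le k)).trans h)

theorem leg_eq_zero_of_arm_eq_zero (Y : YoungDiagram) {k : ℕ} (h : Y.arm k = 0) :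
    Y.leg k = 0 := by
  have := Y.lt_colLen_iff_lt_rowLen (i := k) (j := k)
  unfold arm at h
  unfold leg
  omega

theorem arm_succ_lt (Y : YoungDiagram) {k : ℕ} (h : Y.arm k ≠ 0) : Y.arm (k + 1) < Y.arm k := by
  have := Y.rowLen_anti k (k + 1) (Nat.le_succ k)
  unfold arm at *
  omega

theorem leg_succ_lt (Y : YoungDiagram) {k : ℕ} (h : Y.arm (k + 1) ≠ 0) :
    Y.leg (k + 1) < Y.leg k := by
  have := Y.lt_colLen_iff_lt_rowLen (i := k + 1) (j := k + 1)
  have := Y.colLen_anti k (k + 1) (Nat.le_succ k)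
  unfold arm at h
  unfold leg
  omega

theorem mem_iff_arm_leg (Y : YoungDiagram) (i j : ℕ) :
    (i, j) ∈ Y ↔ i ≤ j ∧ j < Y.arm i + i ∨ j < i ∧ i ≤ Y.leg j + j := by
  have := Y.lt_colLen_iff_lt_rowLen (i := i) (j := j)
  rw [mem_iff_lt_rowLen]
  unfold arm leg
  omega

theorem card_filter_min (Y : YoungDiagram) (k : ℕ) :
    (Y.cells.filter fun c => min c.1 c.2 = k).card = Y.arm k + Y.leg k := by
  have h : Y.cells.filter (fun c => min c.1 c.2 = k) =
      (Finset.Ico k (Y.rowLen k)).image (fun j => (k, j)) ∪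
        (Finset.Ico (k + 1) (Y.colLen k)).image (fun i => (i, k)) := by
    ext ⟨i, j⟩
    simp only [Finset.mem_filter, mem_cells, Finset.mem_union, Finset.mem_image, Finset.mem_Ico,
      Prod.mk.injEq]
    constructor
    · rintro ⟨hY, hk⟩
      rcases le_or_gt i j with hij | hij
      · obtain rfl : i = k := by omega
        exact Or.inl ⟨j, ⟨hij, mem_iff_lt_rowLen.1 hY⟩, rfl, rfl⟩
      · obtain rfl : j = k := by omega
        exact Or.inr ⟨i, ⟨hij, mem_iff_lt_colLen.1 hY⟩, rfl, rfl⟩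
    · rintro (⟨j, ⟨h1, h2⟩, rfl, rfl⟩ | ⟨i, ⟨h1, h2⟩, rfl, rfl⟩)
      · exact ⟨mem_iff_lt_rowLen.2 h2, by omega⟩
      · exact ⟨mem_iff_lt_colLen.2 h2, by omega⟩
  rw [h, Finset.card_union_of_disjoint, Finset.card_image_of_injective,
    Finset.card_image_of_injective, Nat.card_Ico, Nat.card_Ico]
  · rfl
  · intro a b hab
    exact congrArg Prod.fst hab
  · intro a b hab
    exact congrArg Prod.snd hab
  · rw [Finset.disjoint_left]
    rintro ⟨i, j⟩ h1 h2
    simp only [Finset.mem_image, Finset.mem_Ico, Prod.mk.injEq] at h1 h2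
    omega

/-- Schmidt's map: the sequence `arm 0 + leg 0, arm 1 + leg 0, arm 1 + leg 1, arm 2 + leg 1, …`,
whose even-indexed terms are the diagonal hook lengths. -/
def schmidtPtn (Y : YoungDiagram) : Ptn where
  parts n := Y.arm ((n + 1) / 2) + Y.leg (n / 2)
  antitone' _ _ h := add_le_add (Y.arm_antitone (by omega)) (Y.leg_antitone (by omega))
  finite_support' := by
    refine (Set.finite_Iio (2 * Y.rowLen 0)).subset fun n hn => ?_
    rw [Set.mem_Iio]
    by_contra! h
    refine hn ?_
    dsimp only
    rw [Y.arm_eq_zero (by omega),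
      Y.leg_eq_zero_of_arm_eq_zero (Y.arm_eq_zero (by omega)), add_zero]

theorem schmidtPtn_parts_even (Y : YoungDiagram) (k : ℕ) :
    Y.schmidtPtn.parts (2 * k) = Y.arm k + Y.leg k := by
  change Y.arm ((2 * k + 1) / 2) + Y.leg (2 * k / 2) = _
  congr 2 <;> omega

theorem schmidtPtn_parts_odd (Y : YoungDiagram) (k : ℕ) :
    Y.schmidtPtn.parts (2 * k + 1) = Y.arm (k + 1) + Y.leg k := by
  change Y.arm ((2 * k + 1 + 1) / 2) + Y.leg ((2 * k + 1) / 2) = _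
  congr 2 <;> omega

theorem finsum_schmidtPtn_parts_even (Y : YoungDiagram) :
    ∑ᶠ k, Y.schmidtPtn.parts (2 * k) = Y.card := by
  rw [YoungDiagram.card, Finset.card_eq_finsum_card_fiber _ fun c => min c.1 c.2]
  exact finsum_congr fun k => by rw [card_filter_min, schmidtPtn_parts_even]

theorem schmidtPtn_distinct (Y : YoungDiagram) : Y.schmidtPtn.Distinct := by
  intro n hn
  rcases Nat.even_or_odd' n with ⟨k, rfl | rfl⟩
  · rw [schmidtPtn_parts_odd] at hn ⊢
    rw [schmidtPtn_parts_even]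
    have h : Y.arm k ≠ 0 := fun h => by
      have := Y.leg_eq_zero_of_arm_eq_zero h
      have := Y.arm_antitone (show k ≤ k + 1 by omega)
      omega
    have := Y.arm_succ_lt h
    omega
  · rw [show 2 * k + 1 + 1 = 2 * (k + 1) by ring, schmidtPtn_parts_even] at hn ⊢
    rw [schmidtPtn_parts_odd]
    have h : Y.arm (k + 1) ≠ 0 := fun h => by
      have := Y.leg_eq_zero_of_arm_eq_zero h
      omega
    have := Y.leg_succ_lt h
    omega

theorem schmidtPtn_injective : Function.Injective schmidtPtn := by
  intro Y Z h
  have heven (k : ℕ) : Y.arm k + Y.leg k = Z.arm k + Z.leg k := by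
    rw [← schmidtPtn_parts_even, ← schmidtPtn_parts_even, h]
  have hodd (k : ℕ) : Y.arm (k + 1) + Y.leg k = Z.arm (k + 1) + Z.leg k := by
    rw [← schmidtPtn_parts_odd, ← schmidtPtn_parts_odd, h]
  have harm' (d : ℕ) : ∀ k, Y.rowLen 0 + Z.rowLen 0 ≤ k + d → Y.arm k = Z.arm k := by
    induction d with
    | zero =>
      intro k hk
      rw [Y.arm_eq_zero (by omega), Z.arm_eq_zero (by omega)]
    | succ d ih =>
      intro k hk
      have := ih (k + 1) (by omega)
      have := heven k
      have := hodd k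
      omega
  have harm (k : ℕ) : Y.arm k = Z.arm k := harm' _ k (Nat.le_add_left _ _)
  have hleg (k : ℕ) : Y.leg k = Z.leg k := by
    have := heven k
    have := harm k
    omega
  ext ⟨i, j⟩
  rw [mem_cells, mem_cells, mem_iff_arm_leg, mem_iff_arm_leg, harm, hleg]

end YoungDiagram

namespace Ptn

theorem exists_interlacing_decomposition (p : Ptn) : ∃ A B : ℕ → ℕ,
    ∀ k, p.parts (2 * k) = A k + B k ∧ p.parts (2 * k + 1) = A (k + 1) + B k := by
  obtain ⟨N, hN⟩ := p.exists_parts_eq_zero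
  let A (k : ℕ) : ℕ := ∑ j ∈ Finset.Ico k N, (p.parts (2 * j) - p.parts (2 * j + 1))
  have hA (k : ℕ) : A k = p.parts (2 * k) - p.parts (2 * k + 1) + A (k + 1) := by
    rcases lt_or_ge k N with hk | hk
    · exact Finset.sum_eq_sum_Ico_succ_bot hk _
    · simp only [A]
      rw [Finset.Ico_eq_empty_of_le hk, Finset.Ico_eq_empty_of_le (by omega), hN (2 * k) (by omega)]
      simp
  have hle' (d : ℕ) : ∀ k, N ≤ k + d → A k ≤ p.parts (2 * k) := by
    induction d with
    | zero =>
      intro k hk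
      simp only [A]
      rw [Finset.Ico_eq_empty_of_le (by omega)]
      simp
    | succ d ih =>
      intro k hk
      have h1 := ih (k + 1) (by omega)
      have h2 := hA k
      have h3 := p.antitone' (show 2 * k ≤ 2 * k + 1 by omega)
      have h4 := p.antitone' (show 2 * k + 1 ≤ 2 * (k + 1) by omega)
      omega
  refine ⟨A, fun k => p.parts (2 * k) - A k, fun k => ?_⟩
  have h1 := hle' N k (Nat.le_add_left _ _)
  have h2 := hA k
  have h3 := p.antitone' (show 2 * k ≤ 2 * k + 1 by omega)
  dsimp only
  omega

end Ptn

namespace YoungDiagram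

theorem exists_arm_leg {A B : ℕ → ℕ} (hA : ∀ k, A k ≠ 0 → A (k + 1) < A k)
    (hAanti : Antitone A) (hB : ∀ k, A (k + 1) ≠ 0 → B (k + 1) < B k)
    (hAB : ∀ k, A k = 0 → B k = 0) : ∃ Y : YoungDiagram, Y.arm = A ∧ Y.leg = B := by
  have hApos {i k : ℕ} (hik : i ≤ k) (hk : A k ≠ 0) : A i ≠ 0 := by
    have := hAanti hik
    omega
  have hAle {i k : ℕ} (hik : i ≤ k) : A k ≠ 0 → A k + k ≤ A i + i := by
    induction k, hik using Nat.le_induction with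
    | base => exact fun _ => le_rfl
    | succ k hik ih =>
      intro hk
      have h := hApos (Nat.le_succ k) hk
      have := ih h
      have := hA k h
      omega
  have hBle {i k : ℕ} (hik : i ≤ k) : A k ≠ 0 → B k + k ≤ B i + i := by
    induction k, hik using Nat.le_induction with
    | base => exact fun _ => le_rfl
    | succ k hik ih =>
      intro hk
      have := ih (hApos (Nat.le_succ k) hk)
      have := hB k hk
      omega
  have hBA {j : ℕ} (hj : B j ≠ 0) : A j ≠ 0 := fun h => hj (hAB j h)
  let S : Set (ℕ × ℕ) :=
    {c | c.1 ≤ c.2 ∧ c.2 < A c.1 + c.1 ∨ c.2 < c.1 ∧ c.1 ≤ B c.2 + c.2}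
  have hS : S.Finite := by
    refine ((Set.finite_Iic (A 0 + B 0)).prod (Set.finite_Iic (A 0 + B 0))).subset ?_
    rintro ⟨i, j⟩ (⟨h1, h2⟩ | ⟨h1, h2⟩) <;> dsimp only at h1 h2 <;>
      simp only [Set.mem_prod, Set.mem_Iic]
    · have := hAle (Nat.zero_le i) (by omega)
      omega
    · have := hBle (Nat.zero_le j) (hBA (by omega))
      omega
  let Y : YoungDiagram := ⟨hS.toFinset, by
    rintro ⟨i, j⟩ ⟨i', j'⟩ ⟨hi, hj⟩ h
    simp only [Set.Finite.coe_toFinset, S, Set.mem_ofPred_eq] at h hi hj ⊢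
    rcases h with ⟨h1, h2⟩ | ⟨h1, h2⟩
    · have hpos : A i ≠ 0 := by omega
      rcases le_or_gt i' j' with h | h
      · have := hAle hi hpos
        omega
      · have := hBle (show j' ≤ i by omega) hpos
        omega
    · have hpos : A j ≠ 0 := hBA (by omega)
      rcases le_or_gt i' j' with h | h
      · have := hAle (h.trans hj) hpos
        omega
      · have := hBle hj hpos
        omega⟩
  have hY (i j : ℕ) : (i, j) ∈ Y ↔ i ≤ j ∧ j < A i + i ∨ j < i ∧ i ≤ B j + j := by
    rw [← mem_cells]
    simp [Y, S]
  refine ⟨Y, funext fun k => eq_of_forall_lt_iff fun d => ?_,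
    funext fun k => eq_of_forall_lt_iff fun d => ?_⟩
  · have h1 := hY k (d + k)
    rw [mem_iff_lt_rowLen] at h1
    unfold arm
    omega
  · have h1 := hY (d + (k + 1)) k
    rw [mem_iff_lt_colLen] at h1
    unfold leg
    omega

theorem exists_schmidtPtn_eq {p : Ptn} (hp : p.Distinct) : ∃ Y : YoungDiagram, Y.schmidtPtn = p := by
  obtain ⟨A, B, hAB⟩ := p.exists_interlacing_decomposition
  have heven (k : ℕ) := (hAB k).1
  have hodd (k : ℕ) := (hAB k).2
  have hAsucc (k : ℕ) : A (k + 1) ≤ A k := by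
    have := p.antitone' (Nat.le_succ (2 * k))
    rw [Nat.succ_eq_add_one, heven, hodd] at this
    omega
  have hdist_odd (k : ℕ) : A (k + 1) + B k ≠ 0 → A (k + 1) < A k := by
    have := hp (2 * k)
    rw [heven, hodd] at this
    omega
  have hdist_even (k : ℕ) : A (k + 1) + B (k + 1) ≠ 0 → B (k + 1) < B k := by
    have := hp (2 * k + 1)
    rw [show 2 * k + 1 + 1 = 2 * (k + 1) by ring, heven, hodd] at this
    omega
  obtain ⟨Y, rfl, rfl⟩ := exists_arm_leg (A := A) (B := B)
    (fun k hk => by have := hdist_odd k; omega) (antitone_nat_of_succ_le hAsucc)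
    (fun k hk => hdist_even k (by omega)) (fun k hk => by have := hdist_odd k; omega)
  refine ⟨Y, Ptn.ext fun n => ?_⟩
  rcases Nat.even_or_odd' n with ⟨k, rfl | rfl⟩
  · rw [schmidtPtn_parts_even, heven]
  · rw [schmidtPtn_parts_odd, hodd]

end YoungDiagram

/-- Schmidt's theorem: the number of partitions of `n` equals the number of
distinct-part partitions `λ` with `λ_1 + λ_3 + λ_5 + ⋯ = n`. -/
theorem schmidt (n : ℕ) :
    {p : Ptn | p.size = n}.ncard
      = {p : Ptn | p.Distinct ∧ (∑ᶠ k : ℕ, p.parts (2 * k)) = n}.ncard := by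
  have hrow : {p : Ptn | p.size = n} = YoungDiagram.rowPtn '' {Y | Y.card = n} := by
    ext p
    obtain ⟨Y, rfl⟩ := YoungDiagram.rowPtn_surjective p
    rw [YoungDiagram.rowPtn_injective.mem_set_image, Set.mem_ofPred_eq, Set.mem_ofPred_eq,
      YoungDiagram.size_rowPtn]
  have hschmidt : {p : Ptn | p.Distinct ∧ (∑ᶠ k : ℕ, p.parts (2 * k)) = n} =
      YoungDiagram.schmidtPtn '' {Y | Y.card = n} := by
    ext p
    constructor
    · rintro ⟨hp, hn⟩
      obtain ⟨Y, rfl⟩ := YoungDiagram.exists_schmidtPtn_eq hp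
      exact ⟨Y, Y.finsum_schmidtPtn_parts_even.symm.trans hn, rfl⟩
    · rintro ⟨Y, hY, rfl⟩
      exact ⟨Y.schmidtPtn_distinct, Y.finsum_schmidtPtn_parts_even.trans hY⟩
  rw [hrow, hschmidt, Set.ncard_image_of_injective _ YoungDiagram.rowPtn_injective,
    Set.ncard_image_of_injective _ YoungDiagram.schmidtPtn_injective]
end

section
/- For all nonnegative integers n and ℓ, the number of partitions of n with exactly ℓ parts equals the number of partitions λ with distinct parts such that λ_1 + λ_3 + λ_5 + ⋯ = n and |λ| = 2n − ℓ. -/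
namespace Ptn

theorem parts_ne_zero_iff (p : Ptn) (i : ℕ) : p.parts i ≠ 0 ↔ i < p.length := by
  have hl : IsLowerSet (Function.support p.parts) := fun a b hba ha hb =>
    ha (Nat.le_zero.mp (hb ▸ p.antitone' hba))
  obtain ⟨n, hn⟩ := hl.eq_univ_or_Iio.resolve_left
    fun h => Set.infinite_univ (h ▸ p.finite_support')
  rw [length, hn, Set.ncard_Iio_nat, ← Function.mem_support, hn, Set.mem_Iio]

theorem parts_eq_zero_iff (p : Ptn) (i : ℕ) : p.parts i = 0 ↔ p.length ≤ i := by
  have := p.parts_ne_zero_iff i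
  omega

theorem length_eq_of_parts_ne_zero_iff {p : Ptn} {n : ℕ}
    (h : ∀ i, p.parts i ≠ 0 ↔ i < n) : p.length = n := by
  rw [length, show Function.support p.parts = Set.Iio n from Set.ext h, Set.ncard_Iio_nat]

theorem size_eq_sum_range {p : Ptn} {n : ℕ} (h : p.length ≤ n) :
    p.size = ∑ i ∈ Finset.range n, p.parts i := by
  refine finsum_eq_sum_of_support_subset _ fun i hi => ?_
  have := (p.parts_ne_zero_iff i).mp hi
  simp only [Finset.coe_range, Set.mem_Iio]
  omega

theorem parts_eq_zero_of_parts_zero {p : Ptn} (h : p.parts 0 = 0) (i : ℕ) : p.parts i = 0 :=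
  Nat.le_zero.mp (h ▸ p.antitone' i.zero_le)

theorem length_eq_zero_of_parts_zero {p : Ptn} (h : p.parts 0 = 0) : p.length = 0 :=
  Nat.le_zero.mp ((p.parts_eq_zero_iff 0).mp h)

theorem size_eq_zero_of_parts_zero {p : Ptn} (h : p.parts 0 = 0) : p.size = 0 := by
  simp [size, parts_eq_zero_of_parts_zero h]

theorem eq_of_parts_zero {p q : Ptn} (hp : p.parts 0 = 0) (hq : q.parts 0 = 0) : p = q :=
  ext fun i => by rw [parts_eq_zero_of_parts_zero hp, parts_eq_zero_of_parts_zero hq]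

/-- Remove the first row and the first column of the Young diagram. -/
def dehook (p : Ptn) : Ptn where
  parts i := p.parts (i + 1) - 1
  antitone' _ _ h := Nat.sub_le_sub_right (p.antitone' (Nat.add_le_add_right h 1)) 1
  finite_support' := by
    refine (Set.finite_Iio p.length).subset fun i hi => ?_
    have h : p.parts (i + 1) - 1 ≠ 0 := hi
    have := p.parts_ne_zero_iff (i + 1)
    simp only [Set.mem_Iio]
    omega

theorem length_dehook_le (p : Ptn) : p.dehook.length ≤ p.length - 1 := by
  have h : p.parts (p.length - 1 + 1) = 0 := (p.parts_eq_zero_iff _).mpr (by omega)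
  exact (p.dehook.parts_eq_zero_iff _).mp (by simp [dehook, h])

theorem dehook_parts_zero_le (p : Ptn) : p.dehook.parts 0 ≤ p.parts 0 - 1 :=
  Nat.sub_le_sub_right (p.antitone' (Nat.zero_le 1)) 1

theorem size_add_one {p : Ptn} (h : p.parts 0 ≠ 0) :
    p.size + 1 = p.parts 0 + p.length + p.dehook.size := by
  obtain ⟨k, hk⟩ := Nat.exists_eq_add_one_of_ne_zero
    ((p.parts_ne_zero_iff 0).mp h).ne'
  have hd := p.length_dehook_le
  rw [size_eq_sum_range hk.le, size_eq_sum_range (p := p.dehook) (n := k) (by omega),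
    Finset.sum_range_succ']
  have : ∑ i ∈ Finset.range k, p.parts (i + 1)
      = ∑ i ∈ Finset.range k, (p.dehook.parts i + 1) := by
    refine Finset.sum_congr rfl fun i hi => ?_
    have := (p.parts_ne_zero_iff (i + 1)).mpr (by rw [Finset.mem_range] at hi; omega)
    simp only [dehook]
    omega
  rw [this, Finset.sum_add_distrib]
  simp only [Finset.sum_const, Finset.card_range, smul_eq_mul]
  omega

theorem size_dehook_lt {p : Ptn} (h : p.parts 0 ≠ 0) : p.dehook.size < p.size := by
  have := size_add_one h
  have := (p.parts_ne_zero_iff 0).mp h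
  omega

/-- Adjoin a first row of length `m` and a first column of length `l` to the Young diagram. -/
def addHook (p : Ptn) (m l : ℕ) (hm : p.parts 0 < m) : Ptn where
  parts
    | 0 => m
    | i + 1 => if i + 1 < l then p.parts i + 1 else 0
  antitone' := by
    refine antitone_nat_of_succ_le fun i => ?_
    cases i with
    | zero => dsimp only; split_ifs <;> omega
    | succ i =>
      have : p.parts (i + 1) ≤ p.parts i := p.antitone' i.le_succ
      dsimp only
      split_ifs <;> omega
  finite_support' := by
    refine (Set.finite_Iic l).subset fun i hi => ?_
    cases i with
    | zero => simp
    | succ i =>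
      by_contra h
      simp only [Set.mem_Iic, not_le] at h
      exact hi (if_neg (by omega))

theorem length_addHook {p : Ptn} {m l : ℕ} (hm : p.parts 0 < m) (hl : 0 < l) :
    (p.addHook m l hm).length = l := by
  refine length_eq_of_parts_ne_zero_iff fun i => ?_
  cases i with
  | zero => simp only [addHook]; omega
  | succ i => simp [addHook]

theorem dehook_addHook {p : Ptn} {m l : ℕ} (hm : p.parts 0 < m) (hl : p.length < l) :
    (p.addHook m l hm).dehook = p := by
  ext i
  have := p.parts_eq_zero_iff i
  simp only [dehook, addHook]
  split_ifs <;> omega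

theorem eq_of_dehook_eq {p q : Ptn} (hd : p.dehook = q.dehook) (h0 : p.parts 0 = q.parts 0)
    (hl : p.length = q.length) : p = q := by
  ext i
  cases i with
  | zero => exact h0
  | succ i =>
    have h : p.parts (i + 1) - 1 = q.parts (i + 1) - 1 := congrArg (fun r => r.parts i) hd
    have := p.parts_ne_zero_iff (i + 1)
    have := q.parts_ne_zero_iff (i + 1)
    omega

/-- Remove the two largest parts. -/
def dropTwo (p : Ptn) : Ptn where
  parts i := p.parts (i + 2)
  antitone' _ _ h := p.antitone' (Nat.add_le_add_right h 2)
  finite_support' := p.finite_support'.preimage (add_left_injective 2).injOn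

theorem finsum_eq_zero_add {f : ℕ → ℕ} (hf : (Function.support f).Finite) :
    ∑ᶠ i, f i = f 0 + ∑ᶠ i, f (i + 1) := by
  obtain ⟨n, hn⟩ := hf.bddAbove
  have hz : ∀ i, f i ≠ 0 → i ≤ n := fun i hi => hn hi
  rw [finsum_eq_sum_of_support_subset f (s := Finset.range (n + 1)),
    finsum_eq_sum_of_support_subset (fun i => f (i + 1)) (s := Finset.range n),
    Finset.sum_range_succ', add_comm]
  · intro i hi
    have := hz _ hi
    simp only [Finset.coe_range, Set.mem_Iio]
    omega
  · intro i hi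
    have := hz _ hi
    simp only [Finset.coe_range, Set.mem_Iio]
    omega

theorem size_eq_add_dropTwo (p : Ptn) :
    p.size = p.parts 0 + p.parts 1 + p.dropTwo.size := by
  rw [size, finsum_eq_zero_add p.finite_support', finsum_eq_zero_add
    (p.finite_support'.preimage (add_left_injective 1).injOn), ← add_assoc]
  rfl

theorem oddSum_eq_add_dropTwo (p : Ptn) :
    ∑ᶠ k, p.parts (2 * k) = p.parts 0 + ∑ᶠ k, p.dropTwo.parts (2 * k) :=
  finsum_eq_zero_add
    (p.finite_support'.preimage (mul_right_injective₀ (two_ne_zero (α := ℕ))).injOn)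

/-- The parts of `Ptn.schmidt`. -/
noncomputable def schmidtParts : Ptn → ℕ → ℕ
  | p, 0 => p.parts 0 + p.length - 1
  | p, 1 => p.parts 0 + p.dehook.length - 1
  | p, j + 2 => schmidtParts p.dehook j

theorem schmidtParts_step (p : Ptn) (j : ℕ) :
    schmidtParts p (j + 1) ≤ schmidtParts p j ∧
      (schmidtParts p (j + 1) ≠ 0 → schmidtParts p (j + 1) < schmidtParts p j) := by
  induction j using Nat.twoStepInduction generalizing p with
  | zero =>
    have := p.length_dehook_le
    have := p.parts_ne_zero_iff 0
    have := p.dehook.parts_ne_zero_iff 0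
    have := p.dehook_parts_zero_le
    simp only [schmidtParts]
    omega
  | one =>
    have := p.dehook.parts_ne_zero_iff 0
    have := p.dehook_parts_zero_le
    simp only [schmidtParts]
    omega
  | more j ih _ => exact ih p.dehook

theorem schmidtParts_eq_zero (p : Ptn) (j : ℕ) (h : 2 * p.length ≤ j) :
    schmidtParts p j = 0 := by
  have := p.parts_ne_zero_iff 0
  have := p.length_dehook_le
  induction j using Nat.twoStepInduction generalizing p with
  | zero => simp only [schmidtParts]; omega
  | one => simp only [schmidtParts]; omega
  | more j ih _ =>
    exact ih p.dehook (by omega) (p.dehook.parts_ne_zero_iff 0) p.dehook.length_dehook_le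

/-- The partition whose `(2k+1)`-st part is the `k`-th principal hook length of `p`, and whose
`(2k+2)`-nd part is the sum of the `k`-th arm and the `(k+1)`-st leg, suitably shifted. -/
noncomputable def schmidt (p : Ptn) : Ptn where
  parts := schmidtParts p
  antitone' := antitone_nat_of_succ_le fun j => (schmidtParts_step p j).1
  finite_support' := by
    refine (Set.finite_Iio (2 * p.length)).subset fun j hj => ?_
    by_contra h
    exact hj (schmidtParts_eq_zero p j (not_lt.mp h))

theorem schmidt_parts_zero (p : Ptn) : p.schmidt.parts 0 = p.parts 0 + p.length - 1 := rfl

theorem schmidt_parts_one (p : Ptn) :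
    p.schmidt.parts 1 = p.parts 0 + p.dehook.length - 1 := rfl

theorem dropTwo_schmidt (p : Ptn) : p.schmidt.dropTwo = p.dehook.schmidt := rfl

theorem distinct_schmidt (p : Ptn) : p.schmidt.Distinct := fun j => (schmidtParts_step p j).2

theorem schmidt_parts_zero_eq_zero_iff (p : Ptn) : p.schmidt.parts 0 = 0 ↔ p.parts 0 = 0 := by
  have := p.parts_ne_zero_iff 0
  rw [schmidt_parts_zero]
  omega

theorem oddSum_schmidt (p : Ptn) : ∑ᶠ k, p.schmidt.parts (2 * k) = p.size := by
  induction hn : p.size using Nat.strong_induction_on generalizing p with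
  | _ n ih =>
    subst hn
    by_cases h : p.parts 0 = 0
    · have h' := p.schmidt_parts_zero_eq_zero_iff.mpr h
      simp [parts_eq_zero_of_parts_zero h', size_eq_zero_of_parts_zero h]
    · rw [oddSum_eq_add_dropTwo, dropTwo_schmidt, ih _ (size_dehook_lt h) _ rfl,
        schmidt_parts_zero]
      have := size_add_one h
      omega

theorem size_schmidt_add_length (p : Ptn) : p.schmidt.size + p.length = 2 * p.size := by
  induction hn : p.size using Nat.strong_induction_on generalizing p with
  | _ n ih =>
    subst hn
    by_cases h : p.parts 0 = 0
    · have h' := p.schmidt_parts_zero_eq_zero_iff.mpr h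
      simp [size_eq_zero_of_parts_zero h', size_eq_zero_of_parts_zero h,
        length_eq_zero_of_parts_zero h]
    · rw [size_eq_add_dropTwo, dropTwo_schmidt, schmidt_parts_zero, schmidt_parts_one]
      have := ih _ (size_dehook_lt h) _ rfl
      have := size_add_one h
      omega

theorem schmidt_injective : Function.Injective schmidt := by
  intro p q hpq
  induction hn : p.size using Nat.strong_induction_on generalizing p q with
  | _ n ih =>
    subst hn
    have hz : p.parts 0 = 0 ↔ q.parts 0 = 0 := by
      rw [← schmidt_parts_zero_eq_zero_iff, hpq, schmidt_parts_zero_eq_zero_iff]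
    by_cases h : p.parts 0 = 0
    · exact eq_of_parts_zero h (hz.mp h)
    · have hd : p.dehook = q.dehook :=
        ih _ (size_dehook_lt h) (congrArg dropTwo hpq) rfl
      have h0 := congrArg (fun r => r.parts 0) hpq
      have h1 := congrArg (fun r => r.parts 1) hpq
      simp only [schmidt_parts_zero, schmidt_parts_one, hd] at h0 h1
      exact eq_of_dehook_eq hd (by omega) (by omega)

theorem exists_schmidt_eq {q : Ptn} (hq : q.Distinct) : ∃ p : Ptn, p.schmidt = q := by
  induction hn : q.size using Nat.strong_induction_on generalizing q with
  | _ n ih =>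
    subst hn
    by_cases h : q.parts 0 = 0
    · refine ⟨q, eq_of_parts_zero (q.schmidt_parts_zero_eq_zero_iff.mpr h) h⟩
    · have hs := q.size_eq_add_dropTwo
      obtain ⟨p, hp⟩ := ih q.dropTwo.size (by omega) (q := q.dropTwo) (fun i => hq (i + 2)) rfl
      have h2 : p.parts 0 + p.length - 1 = q.parts 2 := congrArg (fun r => r.parts 0) hp
      have hlen := p.parts_ne_zero_iff 0
      have h01 := hq 0
      have h12 := hq 1
      simp only [zero_add, Nat.reduceAdd] at h01 h12
      have hle := q.antitone' (show 1 ≤ 2 by omega)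
      have hm : p.parts 0 < q.parts 1 + 1 - p.length := by omega
      have hl : p.length < p.length + q.parts 0 - q.parts 1 := by omega
      refine ⟨p.addHook _ (p.length + q.parts 0 - q.parts 1) hm, ext fun i => ?_⟩
      match i with
      | 0 =>
        rw [schmidt_parts_zero, length_addHook hm (by omega)]
        simp only [addHook]
        omega
      | 1 =>
        rw [schmidt_parts_one, dehook_addHook hm hl]
        simp only [addHook]
        omega
      | i + 2 =>
        change ((p.addHook _ _ hm).dehook.schmidt).parts i = q.dropTwo.parts i
        rw [dehook_addHook hm hl, hp]

end Ptn

/-- Refinement of Schmidt's theorem: partitions of `n` with `ℓ` parts are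
equinumerous with distinct-part partitions `λ` with `λ_1 + λ_3 + λ_5 + ⋯ = n`
and `|λ| = 2n - ℓ`. -/
theorem schmidt_refinement (n ℓ : ℕ) :
    {p : Ptn | p.size = n ∧ p.length = ℓ}.ncard
      = {p : Ptn | p.Distinct ∧ (∑ᶠ k : ℕ, p.parts (2 * k)) = n ∧
          (p.size : ℤ) = 2 * (n : ℤ) - (ℓ : ℤ)}.ncard := by
  refine Set.BijOn.ncard_eq (f := Ptn.schmidt) ⟨?_, Ptn.schmidt_injective.injOn, ?_⟩
  · rintro p ⟨rfl, rfl⟩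
    have := p.size_schmidt_add_length
    exact ⟨p.distinct_schmidt, p.oddSum_schmidt, by omega⟩
  · rintro q ⟨hq, hn, hs⟩
    obtain ⟨p, rfl⟩ := Ptn.exists_schmidt_eq hq
    have := p.size_schmidt_add_length
    rw [p.oddSum_schmidt] at hn
    exact ⟨p, ⟨hn, by omega⟩, rfl⟩
end

section
/- For all nonnegative integers n and N, the number of partitions λ with distinct parts such that λ_1 + λ_3 + λ_5 + ⋯ = n and |λ| = N equals the number of partitions μ with all parts odd such that |μ| = N and |μ| + ℓ(μ) = 2n. (This is the coefficient-wise form of the identity ∑_{λ∈𝒟} z^{|λ|} q^{λ_1+λ_3+λ_5+⋯} = 1/(qz; qz²)_∞.) -/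
/-- A recursive form of Sylvester's bijection from partitions into distinct parts to partitions
into odd parts, both written as weakly decreasing lists of positive integers. -/
def sylvester : List ℕ → List ℕ
  | [] => []
  | [x] => List.replicate x 1
  | x :: y :: l =>
    (2 * (y - (sylvester l).length) + 1) ::
      ((sylvester l).map (· + 2) ++
        List.replicate (x - (y - (sylvester l).length) - (sylvester l).length - 1) 1)

/-- The sum of the first, third, fifth, … entries of a list. -/
def oddIndexSum : List ℕ → ℕ
  | [] => 0
  | [x] => x
  | x :: _ :: l => x + oddIndexSum l

/-- The lists of parts of partitions into distinct parts. -/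
def IsDistinctList (l : List ℕ) : Prop := l.Pairwise (· > ·) ∧ ∀ x ∈ l, 0 < x

/-- The lists of parts of partitions into odd parts. -/
def IsOddList (l : List ℕ) : Prop := l.Pairwise (· ≥ ·) ∧ ∀ x ∈ l, Odd x

theorem IsDistinctList.of_cons {x : ℕ} {l : List ℕ} (h : IsDistinctList (x :: l)) :
    IsDistinctList l :=
  ⟨(List.pairwise_cons.1 h.1).2, fun z hz => h.2 z (List.mem_cons_of_mem _ hz)⟩

theorem List.sum_map_add_two (l : List ℕ) : (l.map (· + 2)).sum = l.sum + 2 * l.length := by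
  induction l with
  | nil => rfl
  | cons x l ih => simp only [List.map_cons, List.sum_cons, List.length_cons, ih]; ring

theorem sylvester_spec (l : List ℕ) (hl : IsDistinctList l) :
    IsOddList (sylvester l) ∧ (sylvester l).sum = l.sum ∧
      (sylvester l).sum + (sylvester l).length = 2 * oddIndexSum l ∧
      (∀ b, (∀ z ∈ l, z ≤ b) → (sylvester l).length ≤ b) ∧
      ∀ b, (∀ z ∈ l, z ≤ b) → ∀ w ∈ sylvester l, w + 2 * (sylvester l).length ≤ 2 * b + 1 := by
  induction l using sylvester.induct with
  | case1 => simp [sylvester, oddIndexSum, IsOddList]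
  | case2 x =>
    refine ⟨⟨?_, ?_⟩, ?_, ?_, ?_, ?_⟩
    · simp [sylvester, List.pairwise_replicate]
    · simp [sylvester]
    · simp [sylvester]
    · simp [sylvester, oddIndexSum]; ring
    · simp [sylvester]
    · intro b hb w hw
      simp [sylvester] at hb hw ⊢
      omega
  | case3 x y l ih =>
    obtain ⟨⟨hs, ho⟩, hsum, hlen, hb1, hb2⟩ := ih hl.of_cons.of_cons
    have hxy : y < x := (List.pairwise_cons.1 hl.1).1 y (by simp)
    have hy : 0 < y := hl.2 y (by simp)
    have hyl : ∀ z ∈ l, z ≤ y - 1 := fun z hz => by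
      have : z < y := (List.pairwise_cons.1 hl.of_cons.1).1 z hz
      omega
    have h1 := hb1 _ hyl
    have h2 := hb2 _ hyl
    simp only [sylvester, oddIndexSum]
    generalize sylvester l = u at *
    refine ⟨⟨?_, ?_⟩, ?_, ?_, ?_, ?_⟩
    · simp only [List.pairwise_cons, List.pairwise_append, List.pairwise_map,
        List.pairwise_replicate, List.mem_append, List.mem_map, List.mem_replicate]
      refine ⟨?_, ?_, by simp, ?_⟩
      · rintro z (⟨w, hw, rfl⟩ | ⟨-, rfl⟩)
        · have := h2 w hw
          omega
        · omega
      · exact hs.imp fun h => by omega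
      · rintro _ ⟨w, -, rfl⟩ _ ⟨-, rfl⟩
        omega
    · simp only [List.mem_cons, List.mem_append, List.mem_map, List.mem_replicate]
      rintro z (rfl | ⟨w, hw, rfl⟩ | ⟨-, rfl⟩)
      · exact odd_two_mul_add_one _
      · exact (ho w hw).add_even even_two
      · exact odd_one
    · simp only [List.sum_cons, List.sum_append, List.sum_map_add_two, List.sum_replicate,
        smul_eq_mul]
      omega
    · simp only [List.sum_cons, List.sum_append, List.sum_map_add_two, List.sum_replicate,
        smul_eq_mul, List.length_cons, List.length_append, List.length_map, List.length_replicate]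
      omega
    · intro b hb
      have := hb x (by simp)
      simp only [List.length_cons, List.length_append, List.length_map, List.length_replicate]
      omega
    · intro b hb w hw
      have := hb x (by simp)
      simp only [List.length_cons, List.length_append, List.length_map, List.length_replicate]
      simp only [List.mem_cons, List.mem_append, List.mem_map, List.mem_replicate] at hw
      rcases hw with rfl | ⟨w, hw, rfl⟩ | ⟨-, rfl⟩
      · omega
      · have := h2 w hw
        omega
      · omega

theorem IsDistinctList.length_sylvester_lt {y : ℕ} {l : List ℕ} (h : IsDistinctList (y :: l)) :
    (sylvester l).length < y := by
  have hy : 0 < y := h.2 y (by simp)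
  have := (sylvester_spec l h.of_cons).2.2.2.1 (y - 1) fun z hz => by
    have : z < y := (List.pairwise_cons.1 h.1).1 z hz
    omega
  omega

theorem List.map_add_two_append_replicate_inj {u v : List ℕ} {r s : ℕ}
    (h : u.map (· + 2) ++ List.replicate r 1 = v.map (· + 2) ++ List.replicate s 1) :
    u = v := by
  induction u generalizing v with
  | nil =>
    cases v with
    | nil => rfl
    | cons b v => cases r <;> simp [List.replicate_succ] at h
  | cons a u ih =>
    cases v with
    | nil => cases s <;> simp [List.replicate_succ] at h
    | cons b v =>
      simp only [List.map_cons, List.cons_append, List.cons.injEq] at h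
      rw [ih h.2, Nat.add_right_cancel h.1]

theorem sylvester_injOn : Set.InjOn sylvester {l | IsDistinctList l} := by
  intro l hl l' hl' h
  simp only [Set.mem_ofPred_eq] at hl hl'
  induction l using sylvester.induct generalizing l' with
  | case1 =>
    match l', hl', h with
    | [], _, _ => rfl
    | [x], hl', h =>
      have : 0 < x := hl'.2 x (by simp)
      simp [sylvester] at h
      omega
    | x :: y :: l, hl', h => simp [sylvester] at h
  | case2 x =>
    have hx : 0 < x := hl.2 x (by simp)
    match l', hl', h with
    | [], _, h =>
      simp [sylvester] at h
      omega
    | [x'], hl', h => simpa [sylvester] using congrArg List.length h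
    | x' :: y :: l, hl', h =>
      have := hl'.of_cons.length_sylvester_lt
      obtain ⟨x, rfl⟩ := Nat.exists_eq_succ_of_ne_zero hx.ne'
      simp only [sylvester, List.replicate_succ, List.cons.injEq] at h
      omega
  | case3 x y l ih =>
    have hm := hl.of_cons.length_sylvester_lt
    have hxy : y < x := (List.pairwise_cons.1 hl.1).1 y (by simp)
    match l', hl', h with
    | [], _, h => simp [sylvester] at h
    | [x'], hl', h =>
      have hx' : 0 < x' := hl'.2 x' (by simp)
      obtain ⟨x', rfl⟩ := Nat.exists_eq_succ_of_ne_zero hx'.ne'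
      simp only [sylvester, List.replicate_succ, List.cons.injEq] at h
      omega
    | x' :: y' :: l', hl', h =>
      have hm' := hl'.of_cons.length_sylvester_lt
      have hxy' : y' < x' := (List.pairwise_cons.1 hl'.1).1 y' (by simp)
      have hlen := congrArg List.length h
      simp only [sylvester, List.length_cons, List.length_append, List.length_map,
        List.length_replicate] at hlen
      simp only [sylvester, List.cons.injEq] at h
      have hu := List.map_add_two_append_replicate_inj h.2
      obtain rfl := ih hl.of_cons.of_cons hl'.of_cons.of_cons hu
      have hy : y = y' := by omega
      have hx : x = x' := by omega
      rw [hx, hy]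

theorem IsOddList.exists_eq_map_add_two_append {t : List ℕ} (ht : IsOddList t) :
    ∃ u r, IsOddList u ∧ t = u.map (· + 2) ++ List.replicate r 1 := by
  induction t with
  | nil => exact ⟨[], 0, ⟨by simp, by simp⟩, rfl⟩
  | cons a t ih =>
    have h1 := List.pairwise_cons.1 ht.1
    obtain ⟨u, r, hu, rfl⟩ := ih ⟨h1.2, fun z hz => ht.2 z (List.mem_cons_of_mem _ hz)⟩
    obtain ⟨c, rfl⟩ := ht.2 a (by simp)
    cases c with
    | zero =>
      cases u with
      | nil => exact ⟨[], r + 1, hu, by simp [List.replicate_succ]⟩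
      | cons b u =>
        have := h1.1 (b + 2) (by simp)
        omega
    | succ c =>
      refine ⟨(2 * c + 1) :: u, r, ⟨List.pairwise_cons.2 ⟨fun z hz => ?_, hu.1⟩, ?_⟩, ?_⟩
      · have := h1.1 (z + 2) (by simp [hz])
        omega
      · intro z hz
        rcases List.mem_cons.1 hz with rfl | hz
        · exact odd_two_mul_add_one c
        · exact hu.2 z hz
      · simp; ring

theorem IsDistinctList.exists_head_mem_sylvester {z : ℕ} {l : List ℕ}
    (h : IsDistinctList (z :: l)) :
    ∃ w ∈ sylvester (z :: l), 2 * z + 1 = w + 2 * (sylvester (z :: l)).length := by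
  match l, h with
  | [], h =>
    have : 0 < z := h.2 z (by simp)
    refine ⟨1, ?_, ?_⟩
    · simp [sylvester]; omega
    · simp [sylvester]; ring
  | y :: l, h =>
    have hm := h.of_cons.length_sylvester_lt
    have hzy : y < z := (List.pairwise_cons.1 h.1).1 y (by simp)
    refine ⟨_, List.mem_cons_self, ?_⟩
    simp only [sylvester, List.length_cons, List.length_append, List.length_map,
      List.length_replicate]
    omega

theorem IsOddList.exists_sylvester_eq (t : List ℕ) (ht : IsOddList t) :
    ∃ l, IsDistinctList l ∧ sylvester l = t := by
  induction hk : t.length using Nat.strong_induction_on generalizing t with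
  | _ k ih =>
  cases t with
  | nil => exact ⟨[], ⟨by simp, by simp⟩, by simp [sylvester]⟩
  | cons h t =>
    have h1 := List.pairwise_cons.1 ht.1
    obtain ⟨a, rfl⟩ := ht.2 h (by simp)
    have ht' : IsOddList t := ⟨h1.2, fun z hz => ht.2 z (List.mem_cons_of_mem _ hz)⟩
    obtain ⟨u, r, hu, rfl⟩ := ht'.exists_eq_map_add_two_append
    cases a with
    | zero =>
      cases u with
      | nil => exact ⟨[r + 1], ⟨by simp, by simp⟩, by simp [sylvester, List.replicate_succ]⟩
      | cons b u =>
        have := h1.1 (b + 2) (by simp)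
        have := hu.2 b (by simp)
        omega
    | succ a =>
      have hlt : u.length < k := by
        simp at hk
        omega
      obtain ⟨l, hl, rfl⟩ := ih _ hlt u hu rfl
      set m := (sylvester l).length with hm
      have hhead : ∀ z ∈ l, z < a + 1 + m := by
        cases l with
        | nil => simp
        | cons b l =>
          obtain ⟨w, hw, hbw⟩ := hl.exists_head_mem_sylvester
          have := h1.1 (w + 2) (by simp [hw])
          have hb : b < a + 1 + m := by omega
          intro z hz
          rcases List.mem_cons.1 hz with rfl | hz
          · exact hb
          · exact lt_trans ((List.pairwise_cons.1 hl.1).1 z hz) hb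
      refine ⟨(a + 1 + m + r + 1) :: (a + 1 + m) :: l, ⟨?_, ?_⟩, ?_⟩
      · simp only [List.pairwise_cons, List.mem_cons]
        refine ⟨?_, hhead, hl.1⟩
        rintro z (rfl | hz)
        · omega
        · have := hhead z hz
          omega
      · simp only [List.mem_cons]
        rintro z (rfl | rfl | hz)
        · omega
        · omega
        · exact hl.2 z hz
      · simp only [sylvester, ← hm]
        congr 3 <;> omega

theorem ncard_isDistinctList_eq_ncard_isOddList (n N : ℕ) :
    {l : List ℕ | IsDistinctList l ∧ oddIndexSum l = n ∧ l.sum = N}.ncard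
      = {l : List ℕ | IsOddList l ∧ l.sum = N ∧ l.sum + l.length = 2 * n}.ncard := by
  rw [← (sylvester_injOn.mono fun l hl => hl.1).ncard_image]
  congr 1
  ext t
  constructor
  · rintro ⟨l, ⟨hl, rfl, rfl⟩, rfl⟩
    obtain ⟨h1, h2, h3, -⟩ := sylvester_spec l hl
    exact ⟨h1, h2, h3⟩
  · rintro ⟨ht, hs, hn⟩
    obtain ⟨l, hl, rfl⟩ := ht.exists_sylvester_eq
    obtain ⟨-, h2, h3, -⟩ := sylvester_spec l hl
    exact ⟨l, ⟨hl, by omega, by omega⟩, rfl⟩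

theorem finsum_nat_eq_zero_add {f : ℕ → ℕ} (hf : f.support.Finite) :
    ∑ᶠ i, f i = f 0 + ∑ᶠ i, f (i + 1) := by
  obtain ⟨b, hb⟩ := hf.bddAbove
  have h1 : f.support ⊆ Finset.range (b + 1) := fun i hi => by
    simpa [Nat.lt_succ_iff] using hb hi
  have h2 : (fun i => f (i + 1)).support ⊆ Finset.range b := fun i hi => by
    simpa using hb (show i + 1 ∈ f.support from hi)
  rw [finsum_eq_sum_of_support_subset _ h1, finsum_eq_sum_of_support_subset _ h2,
    Finset.sum_range_succ', add_comm]

theorem List.finite_support_getD (l : List ℕ) : (fun i => l.getD i 0).support.Finite :=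
  (Set.finite_Iio l.length).subset fun i hi => by
    by_contra h
    exact hi (List.getD_eq_default _ _ (by simpa using h))

theorem List.finsum_getD (l : List ℕ) : ∑ᶠ i, l.getD i 0 = l.sum := by
  induction l with
  | nil => simp
  | cons x l ih =>
    rw [finsum_nat_eq_zero_add (List.finite_support_getD _)]
    simp [← ih]

theorem List.finsum_getD_two_mul (l : List ℕ) : ∑ᶠ k, l.getD (2 * k) 0 = oddIndexSum l := by
  have hfin (l : List ℕ) : (fun k => l.getD (2 * k) 0).support.Finite :=
    l.finite_support_getD.preimage (f := fun k => 2 * k) fun a _ b _ h => by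
      simpa using h
  induction l using sylvester.induct with
  | case1 => simp [oddIndexSum]
  | case2 x =>
    rw [finsum_nat_eq_zero_add (hfin _)]
    simp [oddIndexSum, mul_add]
  | case3 x y l ih =>
    rw [finsum_nat_eq_zero_add (hfin _)]
    simp [oddIndexSum, mul_add, ← ih]

namespace Ptn

/-- The list of nonzero parts of a partition. -/
noncomputable def toList (p : Ptn) : List ℕ := (List.range p.length).map p.parts

theorem length_toList (p : Ptn) : p.toList.length = p.length := by simp [toList]

theorem getD_toList (p : Ptn) (i : ℕ) : p.toList.getD i 0 = p.parts i := by
  by_cases h : i < p.length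
  · simp [toList, h]
  · rw [List.getD_eq_default _ _ (by simpa [length_toList] using h)]
    exact (not_not.1 (mt (p.parts_ne_zero_iff i).1 h)).symm

theorem toList_injective : Function.Injective toList := by
  intro p q h
  have : p.parts = q.parts := funext fun i => by rw [← getD_toList, h, getD_toList]
  cases p
  cases q
  congr

theorem pairwise_toList (p : Ptn) : p.toList.Pairwise (· ≥ ·) := by
  rw [toList, List.pairwise_map]
  exact List.pairwise_lt_range.imp fun h => p.antitone' h.le

theorem pos_of_mem_toList (p : Ptn) {x : ℕ} (hx : x ∈ p.toList) : 0 < x := by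
  simp only [toList, List.mem_map, List.mem_range] at hx
  obtain ⟨i, hi, rfl⟩ := hx
  exact Nat.pos_of_ne_zero ((p.parts_ne_zero_iff i).2 hi)

theorem exists_toList_eq {l : List ℕ} (hl : l.Pairwise (· ≥ ·)) (hpos : ∀ x ∈ l, 0 < x) :
    ∃ p : Ptn, p.toList = l := by
  have hanti : ∀ ⦃i j : ℕ⦄, i ≤ j → l.getD j 0 ≤ l.getD i 0 := by
    intro i j hij
    rcases hij.eq_or_lt with rfl | hij
    · rfl
    by_cases hj : j < l.length
    · rw [List.getD_eq_getElem _ _ hj, List.getD_eq_getElem _ _ (hij.trans hj)]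
      exact List.pairwise_iff_getElem.1 hl i j (hij.trans hj) hj hij
    · rw [List.getD_eq_default _ _ (not_lt.1 hj)]
      exact Nat.zero_le _
  let p : Ptn := ⟨fun i => l.getD i 0, hanti, l.finite_support_getD⟩
  have hp (i : ℕ) : i < p.length ↔ i < l.length := by
    rw [← p.parts_ne_zero_iff]
    change l.getD i 0 ≠ 0 ↔ _
    by_cases h : i < l.length
    · rw [List.getD_eq_getElem _ _ h]
      exact iff_of_true (hpos _ (List.getElem_mem h)).ne' h
    · rw [List.getD_eq_default _ _ (not_lt.1 h)]
      simp [h]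
  have hlen : p.length = l.length :=
    le_antisymm (not_lt.1 fun h => lt_irrefl _ ((hp _).1 h))
      (not_lt.1 fun h => lt_irrefl _ ((hp _).2 h))
  refine ⟨p, List.ext_getElem (by rw [length_toList, hlen]) fun i h1 h2 => ?_⟩
  rw [← List.getD_eq_getElem _ 0 h1, getD_toList, ← List.getD_eq_getElem _ 0 h2]

theorem sum_toList (p : Ptn) : p.toList.sum = p.size := by
  simp only [← List.finsum_getD, getD_toList, size]

theorem oddIndexSum_toList (p : Ptn) : oddIndexSum p.toList = ∑ᶠ k : ℕ, p.parts (2 * k) := by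
  simp only [← List.finsum_getD_two_mul, getD_toList]

theorem isDistinctList_toList_iff (p : Ptn) : IsDistinctList p.toList ↔ p.Distinct := by
  constructor
  · intro h i hi
    have hi' := (p.parts_ne_zero_iff _).1 hi
    have := List.pairwise_iff_getElem.1 h.1 i (i + 1) (by rw [length_toList]; omega)
      (by rwa [length_toList]) (Nat.lt_succ_self i)
    simpa [toList] using this
  · intro h
    refine ⟨?_, fun x => p.pos_of_mem_toList⟩
    rw [List.pairwise_iff_getElem]
    intro i j hi hj hij
    rw [length_toList] at hj
    simp only [toList, List.getElem_map, List.getElem_range]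
    have h1 : p.parts (i + 1) ≠ 0 := (p.parts_ne_zero_iff _).2 (by omega)
    exact (p.antitone' (Nat.succ_le_of_lt hij)).trans_lt (h i h1)

theorem isOddList_toList_iff (p : Ptn) : IsOddList p.toList ↔ p.OddParts := by
  rw [IsOddList, and_iff_right p.pairwise_toList]
  simp [OddParts, parts_ne_zero_iff, toList]

theorem ncard_eq_ncard_toList {P : Ptn → Prop} {Q : List ℕ → Prop}
    (hPQ : ∀ p : Ptn, Q p.toList ↔ P p)
    (hQ : ∀ l, Q l → l.Pairwise (· ≥ ·) ∧ ∀ x ∈ l, 0 < x) :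
    {p | P p}.ncard = {l | Q l}.ncard := by
  rw [← Set.ncard_image_of_injective _ toList_injective]
  congr 1
  ext l
  constructor
  · rintro ⟨p, hp, rfl⟩
    exact (hPQ p).2 hp
  · intro hl
    obtain ⟨p, rfl⟩ := exists_toList_eq (hQ l hl).1 (hQ l hl).2
    exact ⟨p, (hPQ p).1 hl, rfl⟩

end Ptn

/-- Coefficient-wise form of `∑_{λ∈𝒟} z^{|λ|} q^{λ_1+λ_3+⋯} = 1/(qz;qz²)_∞`:
distinct-part partitions with odd-index Schmidt weight `n` and size `N` are
equinumerous with odd-part partitions `μ` of size `N` with `|μ| + ℓ(μ) = 2n`. -/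
theorem mork_product_identity_one (n N : ℕ) :
    {p : Ptn | p.Distinct ∧ (∑ᶠ k : ℕ, p.parts (2 * k)) = n ∧ p.size = N}.ncard
      = {p : Ptn | p.OddParts ∧ p.size = N ∧ p.size + p.length = 2 * n}.ncard := by
  rw [Ptn.ncard_eq_ncard_toList
      (Q := fun l => IsDistinctList l ∧ oddIndexSum l = n ∧ l.sum = N)
      (fun p => by rw [p.isDistinctList_toList_iff, p.oddIndexSum_toList, p.sum_toList])
      (fun l hl => ⟨hl.1.1.imp fun h => le_of_lt h, hl.1.2⟩),
    Ptn.ncard_eq_ncard_toList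
      (Q := fun l => IsOddList l ∧ l.sum = N ∧ l.sum + l.length = 2 * n)
      (fun p => by rw [p.isOddList_toList_iff, p.sum_toList, p.length_toList])
      (fun l hl => ⟨hl.1.1, fun x hx => (hl.1.2 x hx).pos⟩)]
  exact ncard_isDistinctList_eq_ncard_isOddList n N
end

section
/- For all nonnegative integers k and n, the number of partitions λ with λ_1 = k and λ_2 + λ_4 + λ_6 + ⋯ = n equals the number of ordered pairs (α, β) of partitions with ℓ(α) + ℓ(β) ≤ k and |α| + |β| = n. (This is the coefficient-wise form of the Bridges–Uncu identity ∑_{λ∈𝒫} z^{λ_1} q^{λ_2+λ_4+λ_6+⋯} = 1/((1−z)(qz;q)_∞²).) -/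
namespace Ptn

theorem exists_forall_ge_parts_eq_zero (p : Ptn) : ∃ N, ∀ i, N ≤ i → p.parts i = 0 := by
  obtain ⟨M, hM⟩ := p.finite_support'.bddAbove
  refine ⟨M + 1, fun i hi => ?_⟩
  by_contra h
  have := hM (Function.mem_support.2 h)
  omega

theorem finsum_eq_sum_range {f : ℕ → ℕ} {N : ℕ} (h : ∀ i, N ≤ i → f i = 0) :
    ∑ᶠ i, f i = ∑ i ∈ Finset.range N, f i := by
  refine finsum_eq_sum_of_support_subset _ fun i hi => ?_
  by_contra hN
  exact hi (h i (by simpa using hN))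

theorem exists_parts_le (p : Ptn) (j : ℕ) : ∃ i, p.parts i ≤ j := by
  obtain ⟨N, hN⟩ := p.exists_forall_ge_parts_eq_zero
  exact ⟨N, by simp [hN N le_rfl]⟩

theorem lt_find_parts_le_iff (p : Ptn) (i j : ℕ) :
    i < Nat.find (p.exists_parts_le j) ↔ j < p.parts i := by
  rw [Nat.lt_find_iff]
  refine ⟨fun h => not_le.1 (h i le_rfl), fun h m hm => not_le.2 (h.trans_le (p.antitone' hm))⟩

/-- The conjugate partition. -/
def conj (p : Ptn) : Ptn where
  parts j := Nat.find (p.exists_parts_le j)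
  antitone' i j hij := Nat.find_mono fun _ h => h.trans hij
  finite_support' := by
    refine (Set.finite_Iio (p.parts 0)).subset fun j hj => ?_
    exact (p.lt_find_parts_le_iff 0 j).1 (Nat.pos_of_ne_zero hj)

theorem lt_conj_parts_iff (p : Ptn) (i j : ℕ) : i < p.conj.parts j ↔ j < p.parts i :=
  p.lt_find_parts_le_iff i j

theorem conj_conj (p : Ptn) : p.conj.conj = p := by
  ext i
  refine eq_of_forall_lt_iff fun j => ?_
  rw [lt_conj_parts_iff, lt_conj_parts_iff]

theorem length_conj (p : Ptn) : p.conj.length = p.parts 0 := by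
  have : Function.support p.conj.parts = (Finset.range (p.parts 0) : Set ℕ) := by
    ext i
    rw [Function.mem_support, ← Nat.pos_iff_ne_zero, lt_conj_parts_iff, Finset.mem_coe,
      Finset.mem_range]
  rw [length, this, Set.ncard_coe_finset, Finset.card_range]

theorem size_eq_sum_sum (p : Ptn) {N : ℕ} (h₀ : p.parts 0 ≤ N) (h : ∀ i, N ≤ i → p.parts i = 0) :
    p.size = ∑ i ∈ Finset.range N, ∑ j ∈ Finset.range N, if j < p.parts i then 1 else 0 := by
  rw [size, finsum_eq_sum_range h]
  refine Finset.sum_congr rfl fun i _ => ?_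
  have hi : p.parts i ≤ N := (p.antitone' (Nat.zero_le i)).trans h₀
  have : {j ∈ Finset.range N | j < p.parts i} = Finset.range (p.parts i) := by
    ext j
    simp only [Finset.mem_filter, Finset.mem_range]
    omega
  rw [← Finset.card_filter, this, Finset.card_range]

theorem size_conj (p : Ptn) : p.conj.size = p.size := by
  obtain ⟨M, hM⟩ := p.exists_forall_ge_parts_eq_zero
  have h₀ : p.conj.parts 0 ≤ max M (p.parts 0) := by
    refine le_of_forall_lt fun i hi => lt_of_not_ge fun hle => ?_
    rw [lt_conj_parts_iff, hM i (by omega)] at hi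
    exact lt_irrefl _ hi
  have h : ∀ i, max M (p.parts 0) ≤ i → p.conj.parts i = 0 := fun i hi => by
    by_contra hne
    have := (p.lt_conj_parts_iff 0 i).1 (Nat.pos_of_ne_zero hne)
    omega
  rw [size_eq_sum_sum p (le_max_right _ _) fun i hi => hM i (le_of_max_le_left hi),
    size_eq_sum_sum _ h₀ h, Finset.sum_comm]
  simp_rw [lt_conj_parts_iff]

theorem conj_injective : Function.Injective conj :=
  Function.LeftInverse.injective conj_conj

/-- The sequence `k, a₀ + b₀, a₁ + b₀, a₁ + b₁, a₂ + b₁, …`. -/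
def interlaceSeq (k : ℕ) (a b : ℕ → ℕ) (i : ℕ) : ℕ :=
  if i = 0 then k else a (i / 2) + b ((i - 1) / 2)

theorem interlaceSeq_odd (k : ℕ) (a b : ℕ → ℕ) (j : ℕ) :
    interlaceSeq k a b (2 * j + 1) = a j + b j := by
  simp only [interlaceSeq, Nat.add_eq_zero_iff, one_ne_zero, and_false, if_false]
  congr 2 <;> omega

theorem interlaceSeq_even (k : ℕ) (a b : ℕ → ℕ) (j : ℕ) :
    interlaceSeq k a b (2 * j + 2) = a (j + 1) + b j := by
  simp only [interlaceSeq, Nat.add_eq_zero_iff, two_ne_zero, and_false, if_false]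
  congr 2 <;> omega

/-- The partition `k, a₀ + b₀, a₁ + b₀, a₁ + b₁, a₂ + b₁, …`. -/
def interlace (k : ℕ) (a b : Ptn) (h : a.parts 0 + b.parts 0 ≤ k) : Ptn where
  parts := interlaceSeq k a.parts b.parts
  antitone' i j hij := by
    unfold interlaceSeq
    have hp (p : Ptn) {x y : ℕ} (hxy : x ≤ y) : p.parts y ≤ p.parts x := p.antitone' hxy
    split_ifs with hj hi hi
    · rfl
    · omega
    · have := hp a (Nat.zero_le (j / 2))
      have := hp b (Nat.zero_le ((j - 1) / 2))
      omega
    · exact Nat.add_le_add (hp a (by omega)) (hp b (by omega))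
  finite_support' := by
    obtain ⟨M, hM⟩ := a.exists_forall_ge_parts_eq_zero
    obtain ⟨N, hN⟩ := b.exists_forall_ge_parts_eq_zero
    refine (Set.finite_Iio (2 * M + 2 * N + 2)).subset fun i hi => ?_
    by_contra hlt
    simp only [Set.mem_Iio, not_lt] at hlt
    refine hi ?_
    simp only [interlaceSeq]
    rw [if_neg (by omega), hM _ (by omega), hN _ (by omega), add_zero]

theorem finsum_interlaceSeq_odd (k : ℕ) (a b : Ptn) :
    ∑ᶠ i, interlaceSeq k a.parts b.parts (2 * i + 1) = a.size + b.size := by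
  simp_rw [interlaceSeq_odd]
  exact finsum_add_distrib a.finite_support' b.finite_support'

theorem eq_of_parts_sub_eq {a a' : Ptn}
    (h : ∀ j, a.parts j + a'.parts (j + 1) = a'.parts j + a.parts (j + 1)) : a = a' := by
  obtain ⟨M, hM⟩ := a.exists_forall_ge_parts_eq_zero
  obtain ⟨N, hN⟩ := a'.exists_forall_ge_parts_eq_zero
  ext j
  have key : ∀ d, a.parts j + a'.parts (j + d) = a'.parts j + a.parts (j + d) := by
    intro d
    induction d with
    | zero => simp [add_comm]
    | succ d ih =>
      have := h (j + d)
      rw [← add_assoc]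
      omega
  have := key (M + N)
  rwa [hM (j + (M + N)) (by omega), hN (j + (M + N)) (by omega)] at this

theorem eq_of_interlaceSeq_eq {k : ℕ} {a b a' b' : Ptn}
    (h : ∀ i, interlaceSeq k a.parts b.parts i = interlaceSeq k a'.parts b'.parts i) :
    a = a' ∧ b = b' := by
  have h₁ (j : ℕ) : a.parts j + b.parts j = a'.parts j + b'.parts j := by
    simpa only [interlaceSeq_odd] using h (2 * j + 1)
  have h₂ (j : ℕ) : a.parts (j + 1) + b.parts j = a'.parts (j + 1) + b'.parts j := by
    simpa only [interlaceSeq_even] using h (2 * j + 2)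
  obtain rfl : a = a' := eq_of_parts_sub_eq fun j => by
    have := h₁ j
    have := h₂ j
    omega
  exact ⟨rfl, by ext j; have := h₁ j; omega⟩

/-- The partition with parts `∑ i ∈ [j, N), d i`. -/
def tailSum (d : ℕ → ℕ) (N : ℕ) : Ptn where
  parts j := ∑ i ∈ Finset.Ico j N, d i
  antitone' _ _ hij := Finset.sum_le_sum_of_subset (Finset.Ico_subset_Ico_left hij)
  finite_support' := by
    refine (Set.finite_Iio N).subset fun j hj => ?_
    by_contra hlt
    rw [Set.mem_Iio, not_lt] at hlt
    exact hj (by simp [Finset.Ico_eq_empty_of_le hlt])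

theorem tailSum_parts_of_le {d : ℕ → ℕ} {N j : ℕ} (h : N ≤ j) : (tailSum d N).parts j = 0 := by
  simp [tailSum, Finset.Ico_eq_empty_of_le h]

theorem tailSum_parts_of_lt {d : ℕ → ℕ} {N j : ℕ} (h : j < N) :
    (tailSum d N).parts j = d j + (tailSum d N).parts (j + 1) :=
  Finset.sum_eq_sum_Ico_succ_bot h d

theorem exists_interlaceSeq_eq (p : Ptn) :
    ∃ a b : Ptn, ∀ i, interlaceSeq (p.parts 0) a.parts b.parts i = p.parts i := by
  obtain ⟨N, hN⟩ := p.exists_forall_ge_parts_eq_zero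
  set a := tailSum (fun i => p.parts (2 * i + 1) - p.parts (2 * i + 2)) N with ha
  set b := tailSum (fun i => p.parts (2 * i + 2) - p.parts (2 * i + 3)) N with hb
  have hodd (j : ℕ) : a.parts j + b.parts j = p.parts (2 * j + 1) := by
    rcases le_total N j with hj | hj
    · rw [ha, hb, tailSum_parts_of_le hj, tailSum_parts_of_le hj, hN _ (by omega)]
    · induction hj using Nat.decreasingInduction with
      | self => rw [ha, hb, tailSum_parts_of_le le_rfl, tailSum_parts_of_le le_rfl, hN _ (by omega)]
      | of_succ j hj ih =>
        rw [ha, hb, tailSum_parts_of_lt hj, tailSum_parts_of_lt hj, ← ha, ← hb]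
        have h₁ := p.antitone' (show 2 * j + 1 ≤ 2 * j + 2 by omega)
        have h₂ := p.antitone' (show 2 * j + 2 ≤ 2 * j + 3 by omega)
        rw [show 2 * (j + 1) + 1 = 2 * j + 3 by ring] at ih
        omega
  have heven (j : ℕ) : a.parts (j + 1) + b.parts j = p.parts (2 * j + 2) := by
    rcases le_or_gt N j with hj | hj
    · rw [ha, hb, tailSum_parts_of_le (by omega), tailSum_parts_of_le hj, hN _ (by omega)]
    · have h₁ := p.antitone' (show 2 * j + 1 ≤ 2 * j + 2 by omega)
      have h₂ := hodd j
      rw [ha, tailSum_parts_of_lt hj, ← ha] at h₂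
      omega
  refine ⟨a, b, fun i => ?_⟩
  obtain rfl | ⟨j, rfl | rfl⟩ : i = 0 ∨ ∃ j, i = 2 * j + 1 ∨ i = 2 * j + 2 := by
    rcases Nat.even_or_odd' i with ⟨j, rfl | rfl⟩
    · rcases j with _ | j
      · exact Or.inl rfl
      · exact Or.inr ⟨j, Or.inr (by ring)⟩
    · exact Or.inr ⟨j, Or.inl rfl⟩
  · simp [interlaceSeq]
  · rw [interlaceSeq_odd, hodd]
  · rw [interlaceSeq_even, heven]

theorem length_eq_conj_parts_zero (p : Ptn) : p.length = p.conj.parts 0 := by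
  rw [← length_conj, conj_conj]

end Ptn

open Ptn in
/-- Coefficient-wise form of the Bridges–Uncu identity
`∑_{λ∈𝒫} z^{λ_1} q^{λ_2+λ_4+λ_6+⋯} = 1/((1-z)(qz;q)_∞²)`. -/
theorem bridges_uncu_two (k n : ℕ) :
    {p : Ptn | p.parts 0 = k ∧ (∑ᶠ i : ℕ, p.parts (2 * i + 1)) = n}.ncard
      = {q : Ptn × Ptn | q.1.length + q.2.length ≤ k ∧ q.1.size + q.2.size = n}.ncard := by
  symm
  refine Set.ncard_congr (fun q hq => interlace k q.1.conj q.2.conj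
    (by simpa only [length_eq_conj_parts_zero] using hq.1)) ?_ ?_ ?_
  · rintro ⟨a, b⟩ ⟨-, hn⟩
    refine ⟨rfl, ?_⟩
    refine (finsum_interlaceSeq_odd k a.conj b.conj).trans ?_
    rwa [size_conj, size_conj]
  · rintro ⟨a, b⟩ ⟨a', b'⟩ _ _ h
    obtain ⟨ha, hb⟩ := eq_of_interlaceSeq_eq (congrFun (congrArg parts h))
    exact Prod.ext (conj_injective ha) (conj_injective hb)
  · rintro p ⟨rfl, rfl⟩
    obtain ⟨a, b, hab⟩ := p.exists_interlaceSeq_eq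
    refine ⟨(a.conj, b.conj), ⟨?_, ?_⟩, ?_⟩
    · rw [length_conj, length_conj, ← interlaceSeq_odd (p.parts 0), hab]
      exact p.antitone' (Nat.zero_le _)
    · rw [size_conj, size_conj, ← finsum_interlaceSeq_odd (p.parts 0)]
      simp_rw [hab]
    · ext i
      simp only [conj_conj]
      exact hab i
end

section
/- Let t be a positive integer, let s ≥ 1 and 1 ≤ j ≤ t be integers, and let n be a nonnegative integer. The number of partitions λ with ℓ(λ) = (s−1)t + j and λ_1 + λ_{t+1} + λ_{2t+1} + ⋯ = n equals the number of t-tuples (μ^(1), …, μ^(t)) of partitions with |μ^(1)| + ⋯ + |μ^(t)| = n such that max_{1≤i≤t} ℓ(μ^(i)) = s and j = max{ i : ℓ(μ^(i)) = s }. -/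
namespace Ptn

/-- The partition whose conjugate has exactly `m c` parts equal to `c + 1`. -/
def ofMult (m : ℕ →₀ ℕ) : Ptn where
  parts a := ∑ c ∈ m.support with a ≤ c, m c
  antitone' a b hab := Finset.sum_le_sum_of_subset fun c hc => by
    simp only [Finset.mem_filter] at hc ⊢
    exact ⟨hc.1, hab.trans hc.2⟩
  finite_support' := by
    refine (Set.finite_Iic (m.support.sup id)).subset fun a ha => ?_
    obtain ⟨c, hc, -⟩ := Finset.exists_ne_zero_of_sum_ne_zero ha
    rw [Finset.mem_filter] at hc
    exact hc.2.trans (Finset.le_sup (f := id) hc.1)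

theorem ofMult_parts_eq_sum (m : ℕ →₀ ℕ) {s : Finset ℕ} (hs : m.support ⊆ s) (a : ℕ) :
    (ofMult m).parts a = ∑ c ∈ s with a ≤ c, m c := by
  refine Finset.sum_subset (Finset.filter_subset_filter _ hs) fun c hc hc' => ?_
  simp only [Finset.mem_filter, Finsupp.mem_support_iff] at hc hc'
  tauto

theorem ofMult_parts_eq_add (m : ℕ →₀ ℕ) (a : ℕ) :
    (ofMult m).parts a = m a + (ofMult m).parts (a + 1) := by
  rw [ofMult_parts_eq_sum m (Finset.subset_insert a _),
    ofMult_parts_eq_sum m (Finset.subset_insert a _)]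
  have h : {c ∈ insert a m.support | a ≤ c} = insert a {c ∈ insert a m.support | a + 1 ≤ c} := by
    ext c
    simp only [Finset.mem_filter, Finset.mem_insert]
    grind
  rw [h, Finset.sum_insert (by simp)]

theorem ofMult_injective : Function.Injective ofMult := fun m m' h => by
  ext a
  have h₁ := ofMult_parts_eq_add m a
  have h₂ := ofMult_parts_eq_add m' a
  rw [h] at h₁
  omega

theorem ofMult_surjective : Function.Surjective ofMult := fun p => by
  have hzero : ∃ N, ∀ c, N ≤ c → p.parts c = 0 := by
    obtain ⟨N, hN⟩ := p.finite_support'.bddAbove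
    refine ⟨N + 1, fun c hc => by_contra fun h => ?_⟩
    have := hN (Function.mem_support.2 h)
    omega
  obtain ⟨N, hN⟩ := hzero
  let m : ℕ →₀ ℕ := Finsupp.onFinset (Finset.range N) (fun c => p.parts c - p.parts (c + 1))
    fun c hc => by
      by_contra h
      rw [Finset.mem_range, not_lt] at h
      simp [hN c h] at hc
  refine ⟨m, ?_⟩
  have hparts : (ofMult m).parts = p.parts := by
    have hlarge (a : ℕ) (ha : N ≤ a) : (ofMult m).parts a = p.parts a := by
      rw [hN a ha, ofMult_parts_eq_sum m Finsupp.support_onFinset_subset]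
      refine Finset.sum_eq_zero fun c hc => ?_
      simp only [Finset.mem_filter, Finset.mem_range] at hc
      omega
    have hstep (a : ℕ) (ha : (ofMult m).parts (a + 1) = p.parts (a + 1)) :
        (ofMult m).parts a = p.parts a := by
      have hm : m a = p.parts a - p.parts (a + 1) := rfl
      have := p.antitone' a.le_succ
      rw [ofMult_parts_eq_add, ha, hm]
      exact Nat.sub_add_cancel this
    funext a
    rcases le_total N a with ha | ha
    · exact hlarge a ha
    · induction ha using Nat.decreasingInduction with
      | self => exact hlarge N le_rfl
      | of_succ a _ ih => exact hstep a ih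
  cases p
  simp only [ofMult, mk.injEq] at hparts ⊢
  exact hparts

/-- Finitely supported multiplicity functions are the same as partitions. -/
noncomputable def multEquiv : (ℕ →₀ ℕ) ≃ Ptn :=
  Equiv.ofBijective ofMult ⟨ofMult_injective, ofMult_surjective⟩

theorem multEquiv_apply (m : ℕ →₀ ℕ) : multEquiv m = ofMult m := rfl

theorem length_ofMult (m : ℕ →₀ ℕ) : (ofMult m).length = m.support.sup (· + 1) := by
  have h : Function.support (ofMult m).parts = Set.Iio (m.support.sup (· + 1)) := by
    ext a
    simp [ofMult, Finset.lt_sup_iff, Finset.sum_eq_zero_iff, and_comm]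
  rw [length, h, ← Finset.coe_Iio, Set.ncard_coe_finset, Nat.card_Iio]

theorem length_ofMult_le {m : ℕ →₀ ℕ} {L : ℕ} :
    (ofMult m).length ≤ L ↔ ∀ c, L ≤ c → m c = 0 := by
  simp only [length_ofMult, Finset.sup_le_iff, Finsupp.mem_support_iff, Nat.succ_le_iff]
  exact forall_congr' fun c => by rw [← not_le, not_imp_not]

theorem length_ofMult_eq_succ {m : ℕ →₀ ℕ} {L : ℕ} :
    (ofMult m).length = L + 1 ↔ m L ≠ 0 ∧ ∀ c, L < c → m c = 0 := by
  have h : (ofMult m).length = L + 1 ↔ (ofMult m).length ≤ L + 1 ∧ ¬ (ofMult m).length ≤ L := by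
    omega
  rw [h, length_ofMult_le, length_ofMult_le]
  constructor
  · rintro ⟨h₁, h₂⟩
    refine ⟨fun hL => h₂ fun c hc => ?_, h₁⟩
    rcases hc.eq_or_lt with rfl | hc
    exacts [hL, h₁ c hc]
  · rintro ⟨h₁, h₂⟩
    exact ⟨h₂, fun h => h₁ (h L le_rfl)⟩

theorem finsum_parts_mul_ofMult (m : ℕ →₀ ℕ) {t : ℕ} (ht : 0 < t) :
    ∑ᶠ k, (ofMult m).parts (k * t) = ∑ᶠ c, m c * (c / t + 1) := by
  set N := m.support.sup id + 1
  have hN (c : ℕ) (hc : c ∈ m.support) : c < N :=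
    Nat.lt_succ_of_le (Finset.le_sup (f := id) hc)
  have hsub : m.support ⊆ Finset.range N := fun c hc => Finset.mem_range.2 (hN c hc)
  rw [finsum_eq_sum_of_support_subset (s := Finset.range N),
    finsum_eq_sum_of_support_subset (s := Finset.range N)]
  · simp only [ofMult_parts_eq_sum m hsub, Finset.sum_filter]
    rw [Finset.sum_comm]
    refine Finset.sum_congr rfl fun c hc => ?_
    have hfilter : {k ∈ Finset.range N | k * t ≤ c} = Finset.range (c / t + 1) := by
      ext k
      have := Nat.div_le_self c t
      simp only [Finset.mem_filter, Finset.mem_range, ← Nat.le_div_iff_mul_le ht] at hc ⊢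
      omega
    rw [← Finset.sum_filter, hfilter, Finset.sum_const, Finset.card_range, smul_eq_mul, mul_comm]
  · intro c hc
    exact hsub (Finsupp.mem_support_iff.2 (left_ne_zero_of_mul hc))
  · intro k hk
    obtain ⟨c, hc, -⟩ := Finset.exists_ne_zero_of_sum_ne_zero hk
    rw [Finset.mem_filter] at hc
    exact Finset.mem_coe.2 (Finset.mem_range.2
      ((Nat.le_mul_of_pos_right k ht).trans_lt (hc.2.trans_lt (hN c hc.1))))

theorem size_ofMult (m : ℕ →₀ ℕ) : (ofMult m).size = ∑ᶠ c, m c * (c + 1) := by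
  simpa [size] using finsum_parts_mul_ofMult m one_pos

end Ptn

/-- Splitting a finitely supported function on `ℕ` according to the residue class modulo `t`. -/
noncomputable def residueEquiv (t : ℕ) [NeZero t] : (ℕ →₀ ℕ) ≃ (Fin t → ℕ →₀ ℕ) :=
  ((Finsupp.domCongr ((Nat.divModEquiv t).trans (Equiv.prodComm _ _))).toEquiv.trans
    Finsupp.curryEquiv).trans Finsupp.equivFunOnFinite

theorem residueEquiv_apply (t : ℕ) [NeZero t] (m : ℕ →₀ ℕ) (i : Fin t) (r : ℕ) :
    residueEquiv t m i r = m (r * t + i) := by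
  simp [residueEquiv, Finsupp.curryEquiv]

theorem finsum_residueEquiv (t : ℕ) [NeZero t] (m : ℕ →₀ ℕ) :
    ∑ i, ∑ᶠ r, residueEquiv t m i r * (r + 1) = ∑ᶠ c, m c * (c / t + 1) := by
  let e : ℕ ≃ Fin t × ℕ := (Nat.divModEquiv t).trans (Equiv.prodComm _ _)
  have hsupp : (Function.support fun c => m c * (c / t + 1)).Finite :=
    m.hasFiniteSupport.subset fun c hc => left_ne_zero_of_mul hc
  rw [← finsum_comp_equiv e.symm, finsum_curry, finsum_eq_sum_of_fintype]
  · refine Finset.sum_congr rfl fun i _ => finsum_congr fun r => ?_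
    have hdiv : (r * t + i) / t = r := by
      rw [mul_comm, Nat.mul_add_div (NeZero.pos t), Nat.div_eq_of_lt i.2, add_zero]
    simp [e, residueEquiv_apply, hdiv]
  · exact hsupp.preimage e.symm.injective.injOn

theorem length_ofMult_iff_residueEquiv {t : ℕ} [NeZero t] (m : ℕ →₀ ℕ) (S : ℕ) (i : Fin t) :
    (Ptn.ofMult m).length = S * t + (i + 1) ↔
      (Finset.univ.sup fun i => (Ptn.ofMult (residueEquiv t m i)).length) = S + 1 ∧
        (Ptn.ofMult (residueEquiv t m i)).length = S + 1 ∧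
          ∀ i', (Ptn.ofMult (residueEquiv t m i')).length = S + 1 → i' ≤ i := by
  rw [← add_assoc, Ptn.length_ofMult_eq_succ]
  constructor
  · rintro ⟨hne, hzero⟩
    have hi : (Ptn.ofMult (residueEquiv t m i)).length = S + 1 := by
      simp only [Ptn.length_ofMult_eq_succ, residueEquiv_apply]
      exact ⟨hne, fun r hr => hzero _ (by gcongr; exact NeZero.pos t)⟩
    refine ⟨le_antisymm (Finset.sup_le fun i' _ => ?_) ?_, hi, fun i' hi' => ?_⟩
    · simp only [Ptn.length_ofMult_le, residueEquiv_apply]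
      exact fun r hr => hzero _ (by nlinarith [i.2])
    · rw [← hi]
      exact Finset.le_sup (f := fun i => (Ptn.ofMult (residueEquiv t m i)).length)
        (Finset.mem_univ i)
    · rw [Ptn.length_ofMult_eq_succ, residueEquiv_apply] at hi'
      by_contra! h
      exact hi'.1 (hzero _ (Nat.add_lt_add_left h _))
  · rintro ⟨hsup, hi, hmax⟩
    rw [Ptn.length_ofMult_eq_succ, residueEquiv_apply] at hi
    refine ⟨hi.1, fun c hc => by_contra fun hm => ?_⟩
    let i' : Fin t := ⟨c % t, Nat.mod_lt _ (NeZero.pos t)⟩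
    have hc' : c / t * t + i' = c := Nat.div_add_mod' c t
    have hle : (Ptn.ofMult (residueEquiv t m i')).length ≤ S + 1 :=
      hsup ▸ Finset.le_sup (f := fun i => (Ptn.ofMult (residueEquiv t m i)).length)
        (Finset.mem_univ i')
    rw [Ptn.length_ofMult_le] at hle
    have hmi : residueEquiv t m i' (c / t) ≠ 0 := by rwa [residueEquiv_apply, hc']
    have hdiv : c / t ≤ S := by
      by_contra! h
      exact hmi (hle _ h)
    have hdiv' : S ≤ c / t := (Nat.le_div_iff_mul_le (NeZero.pos t)).2 (by omega)
    obtain rfl : c / t = S := le_antisymm hdiv hdiv'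
    have := hmax i' (Ptn.length_ofMult_eq_succ.2 ⟨hmi, fun r hr => hle r hr⟩)
    rw [Fin.le_def] at this
    omega

/-- Li–Yee's theorem: partitions `λ` with `ℓ(λ) = (s-1)t + j` and
`λ_1 + λ_{t+1} + λ_{2t+1} + ⋯ = n` are equinumerous with `t`-colored partitions of `n`
(encoded as `t`-tuples `μ` of partitions, `μ i` holding the parts of color `i+1`),
where `s` is the most number of times any color appears and `j` is the largest such color. -/
theorem li_yee (t s j n : ℕ) (ht : 1 ≤ t) (hs : 1 ≤ s) (hj1 : 1 ≤ j) (hjt : j ≤ t) :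
    {p : Ptn | p.length = (s - 1) * t + j ∧ (∑ᶠ k : ℕ, p.parts (k * t)) = n}.ncard
      = {μ : Fin t → Ptn | (∑ i, (μ i).size) = n ∧
          (Finset.univ.sup fun i => (μ i).length) = s ∧
          ∃ i : Fin t, (i : ℕ) + 1 = j ∧ (μ i).length = s ∧
            ∀ i' : Fin t, (μ i').length = s → i' ≤ i}.ncard := by
  have : NeZero t := ⟨by omega⟩
  obtain ⟨S, rfl⟩ : ∃ S, s = S + 1 := ⟨s - 1, by omega⟩
  obtain ⟨i, rfl⟩ : ∃ i : Fin t, j = i + 1 := ⟨⟨j - 1, by omega⟩, by simp; omega⟩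
  let e : Ptn ≃ (Fin t → Ptn) :=
    Ptn.multEquiv.symm.trans ((residueEquiv t).trans (Equiv.piCongrRight fun _ => Ptn.multEquiv))
  refine Nat.card_congr (e.subtypeEquiv fun p => ?_)
  obtain ⟨m, rfl⟩ := Ptn.multEquiv.surjective p
  have he (k : Fin t) : e (Ptn.ofMult m) k = Ptn.ofMult (residueEquiv t m k) := by
    simp [e, ← Ptn.multEquiv_apply]
  simp only [Set.mem_ofPred_eq, Ptn.multEquiv_apply, he, Nat.add_sub_cancel, Ptn.size_ofMult,
    finsum_residueEquiv, Ptn.finsum_parts_mul_ofMult m ht, length_ofMult_iff_residueEquiv]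
  constructor
  · rintro ⟨⟨hsup, hi⟩, hn⟩
    exact ⟨hn, hsup, i, rfl, hi⟩
  · rintro ⟨hn, hsup, i', hi', hi⟩
    obtain rfl : i' = i := Fin.ext (by omega)
    exact ⟨⟨hsup, hi⟩, hn⟩
end
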